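/- arXiv:2209.03478 — 3 statements merged into one kernel-verified Lean document; each statement's English description precedes it below -/
import Mathlib

section
/- For every choice of bit strings Q₁=(q₁,q₂,q₃), Q₂=(q₅,q₆,q₇) ∈ {0,1}³, every sign s ∈ {+1,−1}, and all bits i,j,k ∈ {0,1} with i+j+k odd, the 7-qubit vector v_{y,s} satisfies the eigenvalue equation (P_i ⊗ P_j ⊗ P_k ⊗ Y ⊗ I ⊗ I ⊗ I) v_{y,s} = s · (√−1)^{i+j+k+1} · (−1)^{i q₁ + j q₂ + k q₃} · v_{y,s}. -/
open Matrix Complex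

noncomputable section

/-- Single-qubit Pauli X. -/
def Xg : Matrix (Fin 2) (Fin 2) ℂ := !![0, 1; 1, 0]
/-- Single-qubit Pauli Y. -/
def Yg : Matrix (Fin 2) (Fin 2) ℂ := !![0, -Complex.I; Complex.I, 0]
/-- Single-qubit Pauli Z. -/
def Zg : Matrix (Fin 2) (Fin 2) ℂ := !![1, 0; 0, -1]
/-- P₀ = X, P₁ = Y. -/
def Pg : Fin 2 → Matrix (Fin 2) (Fin 2) ℂ := fun i => if i = 0 then Xg else Yg

/-- Tensor (Kronecker) product of `n` single-qubit operators, as a matrix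
indexed by bit strings. -/
def tens {n : ℕ} (M : Fin n → Matrix (Fin 2) (Fin 2) ℂ) :
    Matrix (Fin n → Fin 2) (Fin n → Fin 2) ℂ :=
  Matrix.of fun r c => ∏ m, M m (r m) (c m)

/-- Computational basis vector |q⟩. -/
def ket {n : ℕ} (q : Fin n → Fin 2) : (Fin n → Fin 2) → ℂ :=
  fun r => if r = q then 1 else 0

/-- The eigenvector v_{y,s} of the paper (7 qubits). -/
def vy (q₁ q₂ q₃ q₅ q₆ q₇ : Fin 2) (s : ℂ) : (Fin 7 → Fin 2) → ℂ :=
  (- ket ![q₁, q₂, q₃, 0, q₅, q₆, q₇] + ket ![q₁+1, q₂+1, q₃+1, 0, q₅, q₆, q₇]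
    + ket ![q₁, q₂, q₃, 0, q₅+1, q₆+1, q₇+1]
    + ket ![q₁+1, q₂+1, q₃+1, 0, q₅+1, q₆+1, q₇+1])
  + s • (- ket ![q₁+1, q₂+1, q₃+1, 1, q₅, q₆, q₇] - ket ![q₁, q₂, q₃, 1, q₅, q₆, q₇]
    + ket ![q₁+1, q₂+1, q₃+1, 1, q₅+1, q₆+1, q₇+1]
    - ket ![q₁, q₂, q₃, 1, q₅+1, q₆+1, q₇+1])

theorem tens_mulVec_ket {n : ℕ} (M : Fin n → Matrix (Fin 2) (Fin 2) ℂ) (q p : Fin n → Fin 2)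
    (c : Fin n → ℂ) (h : ∀ m r, M m r (q m) = if r = p m then c m else 0) :
    (tens M).mulVec (ket q) = (∏ m, c m) • ket p := by
  ext r
  have hsum : (tens M).mulVec (ket q) r = ∏ m, M m (r m) (q m) := by
    simp [Matrix.mulVec, dotProduct, tens, ket]
  simp [hsum, h, Finset.prod_ite_zero, ket, funext_iff]

theorem Pg_apply (i r q : Fin 2) :
    Pg i r q = if r = q + 1 then I ^ (i : ℕ) * (-1) ^ ((i : ℕ) * (q : ℕ)) else 0 := by
  fin_cases i <;> fin_cases r <;> fin_cases q <;> simp [Pg, Xg, Yg]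

theorem neg_one_pow_mul_bit_add_one (i q : Fin 2) :
    (-1 : ℂ) ^ ((i : ℕ) * ((q + 1 : Fin 2) : ℕ)) = (-1) ^ (i : ℕ) * (-1) ^ ((i : ℕ) * (q : ℕ)) := by
  fin_cases i <;> fin_cases q <;> simp

theorem tens_Pg_Yg_mulVec_ket (i j k a b c d e f g : Fin 2) :
    (tens ![Pg i, Pg j, Pg k, Yg, 1, 1, 1]).mulVec (ket ![a, b, c, d, e, f, g]) =
      (I ^ ((i : ℕ) + (j : ℕ) + (k : ℕ) + 1) *
        (-1 : ℂ) ^ ((i : ℕ) * (a : ℕ) + (j : ℕ) * (b : ℕ) + (k : ℕ) * (c : ℕ)) *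
        (-1) ^ (d : ℕ)) • ket ![a + 1, b + 1, c + 1, d + 1, e, f, g] := by
  have hY (r : Fin 2) : Yg r d = if r = d + 1 then I * (-1) ^ (d : ℕ) else 0 := by
    simpa [Pg] using Pg_apply 1 r d
  rw [tens_mulVec_ket _ _ ![a + 1, b + 1, c + 1, d + 1, e, f, g]
    ![I ^ (i : ℕ) * (-1) ^ ((i : ℕ) * (a : ℕ)), I ^ (j : ℕ) * (-1) ^ ((j : ℕ) * (b : ℕ)),
      I ^ (k : ℕ) * (-1) ^ ((k : ℕ) * (c : ℕ)), I * (-1) ^ (d : ℕ), 1, 1, 1]]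
  · congr 1
    simp only [Fin.prod_univ_succ, Matrix.cons_val_zero, Matrix.cons_val_succ,
      Finset.univ_eq_empty, Finset.prod_empty]
    ring
  · intro m r
    match m with
    | 0 => exact Pg_apply i r a
    | 1 => exact Pg_apply j r b
    | 2 => exact Pg_apply k r c
    | 3 => exact hY r
    | 4 | 5 | 6 => exact Matrix.one_apply

theorem stmt0 (q₁ q₂ q₃ q₅ q₆ q₇ : Fin 2) (s : ℂ) (hs : s = 1 ∨ s = -1)
    (i j k : Fin 2) (hodd : Odd ((i : ℕ) + (j : ℕ) + (k : ℕ))) :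
    (tens ![Pg i, Pg j, Pg k, Yg, 1, 1, 1]).mulVec (vy q₁ q₂ q₃ q₅ q₆ q₇ s) =
      (s * Complex.I ^ ((i : ℕ) + (j : ℕ) + (k : ℕ) + 1) *
        (-1 : ℂ) ^ ((i : ℕ) * (q₁ : ℕ) + (j : ℕ) * (q₂ : ℕ) + (k : ℕ) * (q₃ : ℕ))) •
        vy q₁ q₂ q₃ q₅ q₆ q₇ s := by
  have hsq : s * s = 1 := by rcases hs with rfl | rfl <;> norm_num
  have hbit (q : Fin 2) : q + 1 + 1 = q := by fin_cases q <;> rfl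
  have hsign : (-1 : ℂ) ^ (i : ℕ) * (-1) ^ (j : ℕ) * (-1) ^ (k : ℕ) = -1 := by
    rw [← pow_add, ← pow_add, hodd.neg_one_pow]
  have hflip : (-1 : ℂ) ^ ((i : ℕ) * ((q₁ + 1 : Fin 2) : ℕ) + (j : ℕ) * ((q₂ + 1 : Fin 2) : ℕ) +
      (k : ℕ) * ((q₃ + 1 : Fin 2) : ℕ)) =
      -(-1) ^ ((i : ℕ) * (q₁ : ℕ) + (j : ℕ) * (q₂ : ℕ) + (k : ℕ) * (q₃ : ℕ)) := by
    simp only [pow_add, neg_one_pow_mul_bit_add_one]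
    linear_combination (-1 : ℂ) ^ ((i : ℕ) * (q₁ : ℕ)) * (-1) ^ ((j : ℕ) * (q₂ : ℕ)) *
      (-1) ^ ((k : ℕ) * (q₃ : ℕ)) * hsign
  simp only [vy, Matrix.mulVec_add, Matrix.mulVec_sub, Matrix.mulVec_neg, Matrix.mulVec_smul,
    tens_Pg_Yg_mulVec_ket, hbit, hflip, zero_add, show (1 + 1 : Fin 2) = 0 from rfl,
    Fin.val_zero, Fin.val_one, pow_zero, pow_one]
  generalize I ^ ((i : ℕ) + (j : ℕ) + (k : ℕ) + 1) = α
  generalize (-1 : ℂ) ^ ((i : ℕ) * (q₁ : ℕ) + (j : ℕ) * (q₂ : ℕ) + (k : ℕ) * (q₃ : ℕ)) = β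
  match_scalars <;>
    first
    | ring1
    | linear_combination α * β * hsq
    | linear_combination -(α * β * hsq)
end
end

section
/- The 2⁷ = 128 vectors v_{y,s}(Q₁,Q₂), as (Q₁, Q₂, s) ranges over {0,1}³ × {0,1}³ × {+1,−1}, are all nonzero and pairwise orthogonal with respect to the standard Hermitian inner product on ℂ^{128}; consequently they form an orthogonal basis of (ℂ²)^{⊗7}. -/
open Matrix Complex

noncomputable section

/-- The family of all 2⁷ vectors v_{y,s}(Q₁,Q₂), indexed by (Q₁, Q₂, sign). -/
def vyFam : (Fin 3 → Fin 2) × (Fin 3 → Fin 2) × Bool → ((Fin 7 → Fin 2) → ℂ) :=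
  fun p => vy (p.1 0) (p.1 1) (p.1 2) (p.2.1 0) (p.2.1 1) (p.2.1 2)
    (if p.2.2 then 1 else -1)

/-- The bit string `Q₁ b Q₂`. -/
def joinBits (Q₁ : Fin 3 → Fin 2) (b : Fin 2) (Q₂ : Fin 3 → Fin 2) : Fin 7 → Fin 2 :=
  ![Q₁ 0, Q₁ 1, Q₁ 2, b, Q₂ 0, Q₂ 1, Q₂ 2]

theorem joinBits_inj {Q₁ Q₂ R₁ R₂ : Fin 3 → Fin 2} {b c : Fin 2} :
    joinBits Q₁ b Q₂ = joinBits R₁ c R₂ ↔ Q₁ = R₁ ∧ b = c ∧ Q₂ = R₂ := by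
  simp [joinBits, funext_iff, Fin.forall_fin_succ, and_assoc]

/-- The overlap `⟨Q|R⟩` of two computational basis vectors. -/
def overlap {n : ℕ} (Q R : Fin n → Fin 2) : ℂ := if Q = R then 1 else 0

theorem star_ket {n : ℕ} (Q : Fin n → Fin 2) : star (ket Q) = ket Q := by
  ext r
  simp [ket, apply_ite]

theorem ket_dotProduct_ket {n : ℕ} (Q R : Fin n → Fin 2) : ket Q ⬝ᵥ ket R = overlap Q R := by
  simp [ket, dotProduct, overlap, eq_comm]

theorem overlap_joinBits (Q₁ Q₂ R₁ R₂ : Fin 3 → Fin 2) (b c : Fin 2) :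
    overlap (joinBits Q₁ b Q₂) (joinBits R₁ c R₂) =
      if b = c then overlap Q₁ R₁ * overlap Q₂ R₂ else 0 := by
  simp only [overlap, joinBits_inj]
  split_ifs <;> simp_all

theorem bits_add_one_add_one {n : ℕ} (Q : Fin n → Fin 2) : Q + 1 + 1 = Q := by
  ext i
  simp only [Pi.add_apply, Pi.one_apply]
  generalize Q i = x
  revert x
  decide

theorem overlap_add_one_left {n : ℕ} (Q R : Fin n → Fin 2) :
    overlap (Q + 1) R = overlap Q (R + 1) := by
  conv_lhs => rw [← bits_add_one_add_one R]
  simp [overlap]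

/-- The sign `s` encoded by a Boolean. -/
def boolSign (b : Bool) : ℂ := if b then 1 else -1

theorem star_boolSign (b : Bool) : star (boolSign b) = boolSign b := by
  cases b <;> simp [boolSign]

theorem vyFam_eq (p : (Fin 3 → Fin 2) × (Fin 3 → Fin 2) × Bool) :
    vyFam p =
      (- ket (joinBits p.1 0 p.2.1) + ket (joinBits (p.1 + 1) 0 p.2.1)
        + ket (joinBits p.1 0 (p.2.1 + 1)) + ket (joinBits (p.1 + 1) 0 (p.2.1 + 1)))
      + boolSign p.2.2 • (- ket (joinBits (p.1 + 1) 1 p.2.1) - ket (joinBits p.1 1 p.2.1)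
        + ket (joinBits (p.1 + 1) 1 (p.2.1 + 1)) - ket (joinBits p.1 1 (p.2.1 + 1))) :=
  rfl

theorem star_vyFam (p : (Fin 3 → Fin 2) × (Fin 3 → Fin 2) × Bool) :
    star (vyFam p) = vyFam p := by
  simp [vyFam_eq, star_ket, star_boolSign]

theorem vyFam_dotProduct_vyFam (p q : (Fin 3 → Fin 2) × (Fin 3 → Fin 2) × Bool) :
    vyFam p ⬝ᵥ vyFam q =
      4 * (1 + boolSign p.2.2 * boolSign q.2.2) *
        (overlap p.1 q.1 * overlap p.2.1 q.2.1) := by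
  simp only [vyFam_eq, add_dotProduct, dotProduct_add, sub_dotProduct, dotProduct_sub,
    neg_dotProduct, dotProduct_neg, smul_dotProduct, dotProduct_smul, ket_dotProduct_ket,
    overlap_joinBits, bits_add_one_add_one, overlap_add_one_left, smul_eq_mul,
    if_true, zero_ne_one, one_ne_zero, if_false]
  ring

theorem star_vyFam_dotProduct_vyFam (p q : (Fin 3 → Fin 2) × (Fin 3 → Fin 2) × Bool) :
    star (vyFam p) ⬝ᵥ vyFam q = if p = q then 8 else 0 := by
  rw [star_vyFam, vyFam_dotProduct_vyFam]
  obtain ⟨Q₁, Q₂, s⟩ := p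
  obtain ⟨R₁, R₂, t⟩ := q
  by_cases h₁ : Q₁ = R₁ <;> by_cases h₂ : Q₂ = R₂ <;> cases s <;> cases t <;>
    simp [overlap, boolSign, h₁, h₂] <;> norm_num

theorem linearIndependent_vyFam : LinearIndependent ℂ vyFam := by
  rw [Fintype.linearIndependent_iff]
  intro g hg p
  have h := congrArg (star (vyFam p) ⬝ᵥ ·) hg
  simpa [dotProduct_sum, dotProduct_smul, star_vyFam_dotProduct_vyFam] using h

theorem stmt2 :
    (∀ p, vyFam p ≠ 0) ∧
    (∀ p q, p ≠ q → ∑ r, (starRingEnd ℂ) (vyFam p r) * vyFam q r = 0) ∧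
    Submodule.span ℂ (Set.range vyFam) = ⊤ := by
  refine ⟨fun p => linearIndependent_vyFam.ne_zero p, fun p q hpq => ?_, ?_⟩
  · exact (star_vyFam_dotProduct_vyFam p q).trans (if_neg hpq)
  · exact linearIndependent_vyFam.span_eq_top_of_card_eq_finrank' (by simp)
end
end

section
/- For all bits i,j,k ∈ {0,1} with i+j+k odd, the 7-qubit unitary W_{1y} satisfies the conjugation identity (√−1)^{i+j+k+1} · W_{1y} (Z^i ⊗ Z^j ⊗ Z^k ⊗ Z ⊗ I ⊗ I ⊗ I) W_{1y}† = P_i ⊗ P_j ⊗ P_k ⊗ Y ⊗ I ⊗ I ⊗ I. -/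
open Matrix Complex

noncomputable section

/-- Single-qubit Hadamard gate. -/
def Hg : Matrix (Fin 2) (Fin 2) ℂ := (Real.sqrt 2)⁻¹ • !![1, 1; 1, -1]

/-- CNOT with control `c` and target `t`, acting on `n` qubits. -/
def CNOTg {n : ℕ} (c t : Fin n) : Matrix (Fin n → Fin 2) (Fin n → Fin 2) ℂ :=
  Matrix.of fun r col => if r = Function.update col t (col t + col c) then 1 else 0

/-- C_I = CNOT_{(4,1)} CNOT_{(4,2)} CNOT_{(4,3)} (qubits 1-indexed in the paper). -/
def CI : Matrix (Fin 7 → Fin 2) (Fin 7 → Fin 2) ℂ := CNOTg 3 0 * CNOTg 3 1 * CNOTg 3 2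
/-- C_{II} = CNOT_{(4,5)} CNOT_{(4,6)} CNOT_{(4,7)}. -/
def CII : Matrix (Fin 7 → Fin 2) (Fin 7 → Fin 2) ℂ := CNOTg 3 4 * CNOTg 3 5 * CNOTg 3 6
/-- W_{1y} = C_I · H_{(4)} · Z_{(4)} · C_I · C_{II} · H_{(4)} · C_I. -/
def W1y : Matrix (Fin 7 → Fin 2) (Fin 7 → Fin 2) ℂ :=
  CI * tens ![1, 1, 1, Hg, 1, 1, 1] * tens ![1, 1, 1, Zg, 1, 1, 1] * CI * CII *
    tens ![1, 1, 1, Hg, 1, 1, 1] * CI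

lemma tens_mul_tens {n : ℕ} (M N : Fin n → Matrix (Fin 2) (Fin 2) ℂ) :
    tens M * tens N = tens fun m => M m * N m := by
  ext r c
  simp only [tens, Matrix.mul_apply, Matrix.of_apply, ← Finset.prod_mul_distrib]
  exact (Fintype.prod_sum fun m x => M m (r m) x * N m x (c m)).symm

lemma tens_conjTranspose {n : ℕ} (M : Fin n → Matrix (Fin 2) (Fin 2) ℂ) :
    (tens M)ᴴ = tens fun m => (M m)ᴴ := by
  ext r c
  simp [tens, Matrix.conjTranspose_apply]

lemma tens_one {n : ℕ} : tens (fun _ : Fin n => 1) = 1 := by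
  ext r c
  simp [tens, Matrix.one_apply, Finset.prod_ite_zero, funext_iff]

lemma tens_smul {n : ℕ} (a : Fin n → ℂ) (M : Fin n → Matrix (Fin 2) (Fin 2) ℂ) :
    tens (fun m => a m • M m) = (∏ m, a m) • tens M := by
  ext r c
  simp [tens, Finset.prod_mul_distrib]

lemma tens_mem_unitaryGroup {n : ℕ} {M : Fin n → Matrix (Fin 2) (Fin 2) ℂ}
    (hM : ∀ m, M m * (M m)ᴴ = 1) : tens M ∈ unitaryGroup (Fin n → Fin 2) ℂ := by
  rw [mem_unitaryGroup_iff, star_eq_conjTranspose, tens_conjTranspose, tens_mul_tens]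
  simp only [hM, tens_one]

lemma semiconjBy_tens {n : ℕ} {U A B : Fin n → Matrix (Fin 2) (Fin 2) ℂ}
    (h : ∀ m, SemiconjBy (U m) (A m) (B m)) : SemiconjBy (tens U) (tens A) (tens B) := by
  simp only [SemiconjBy, tens_mul_tens, fun m => (h m).eq]

/-- The action of `CNOTg c t` on bit strings. -/
def cnotFlip {n : ℕ} (c t : Fin n) (q : Fin n → Fin 2) : Fin n → Fin 2 :=
  Function.update q t (q t + q c)

lemma cnotFlip_involutive {n : ℕ} {c t : Fin n} (h : c ≠ t) :
    Function.Involutive (cnotFlip c t) := by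
  intro q
  have key : ∀ a b : Fin 2, a + b + b = a := by decide
  simp [cnotFlip, Function.update_of_ne h, key]

lemma CNOTg_apply {n : ℕ} (c t : Fin n) (r q : Fin n → Fin 2) :
    CNOTg c t r q = if r = cnotFlip c t q then 1 else 0 := rfl

lemma CNOTg_mul_apply {n : ℕ} {c t : Fin n} (h : c ≠ t)
    (A : Matrix (Fin n → Fin 2) (Fin n → Fin 2) ℂ) (r q : Fin n → Fin 2) :
    (CNOTg c t * A) r q = A (cnotFlip c t r) q := by
  simp [Matrix.mul_apply, CNOTg_apply, ← (cnotFlip_involutive h).eq_iff]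

lemma mul_CNOTg_apply {n : ℕ} (c t : Fin n)
    (A : Matrix (Fin n → Fin 2) (Fin n → Fin 2) ℂ) (r q : Fin n → Fin 2) :
    (A * CNOTg c t) r q = A r (cnotFlip c t q) := by
  simp [Matrix.mul_apply, CNOTg_apply]

lemma CNOTg_mem_unitaryGroup {n : ℕ} {c t : Fin n} (h : c ≠ t) :
    CNOTg c t ∈ unitaryGroup (Fin n → Fin 2) ℂ := by
  rw [mem_unitaryGroup_iff, star_eq_conjTranspose]
  ext r q
  rw [CNOTg_mul_apply h, Matrix.conjTranspose_apply, CNOTg_apply, Matrix.one_apply]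
  simp [cnotFlip_involutive h r, apply_ite (star : ℂ → ℂ), eq_comm]

/-- Conjugation of a product operator by a CNOT only has to be checked on the two qubits
involved. -/
lemma semiconjBy_CNOTg {n : ℕ} {c t : Fin n} (h : c ≠ t)
    {M N : Fin n → Matrix (Fin 2) (Fin 2) ℂ} (hoff : ∀ m, m ≠ c → m ≠ t → M m = N m)
    (hct : ∀ a b x y, M c a x * M t (b + a) y = N c a x * N t b (y + x)) :
    SemiconjBy (CNOTg c t) (tens M) (tens N) := by
  ext r q
  rw [CNOTg_mul_apply h, mul_CNOTg_apply]
  have split (f : Fin n → ℂ) :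
      ∏ m, f m = f c * f t * ∏ m ∈ (Finset.univ.erase c).erase t, f m := by
    rw [mul_assoc, Finset.mul_prod_erase _ _ (by simp [h.symm]),
      Finset.mul_prod_erase _ _ (Finset.mem_univ c)]
  simp only [tens, Matrix.of_apply]
  rw [split, split]
  congr 1
  · simpa [cnotFlip, Function.update_of_ne h] using hct (r c) (r t) (q c) (q t)
  · refine Finset.prod_congr rfl fun m hm => ?_
    simp only [Finset.mem_erase, Finset.mem_univ, and_true] at hm
    simp [cnotFlip, Function.update_of_ne hm.1, hoff m hm.2 hm.1]

lemma Zg_pow (a : ℕ) : Zg ^ a = !![1, 0; 0, (-1) ^ a] := by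
  induction a with
  | zero => simp [Matrix.one_fin_two]
  | succ a ih =>
    rw [pow_succ, ih]
    simp [Zg, pow_succ]

lemma Zg_pow_of_even {a : ℕ} (h : Even a) : Zg ^ a = 1 := by
  simp [Zg_pow, h.neg_one_pow, Matrix.one_fin_two]

lemma Zg_pow_of_odd {a : ℕ} (h : Odd a) : Zg ^ a = Zg := by
  rw [Zg_pow, h.neg_one_pow, Zg]

lemma semiconjBy_CNOTg_Z {n : ℕ} {c t : Fin n} (h : c ≠ t)
    {M N : Fin n → Matrix (Fin 2) (Fin 2) ℂ} (hoff : ∀ m, m ≠ c → m ≠ t → M m = N m)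
    (a b : ℕ) (hMc : M c = Zg ^ a) (hMt : M t = Zg ^ b)
    (hNc : N c = Zg ^ (b + a)) (hNt : N t = Zg ^ b) :
    SemiconjBy (CNOTg c t) (tens M) (tens N) := by
  refine semiconjBy_CNOTg h hoff fun p q x y => ?_
  rw [hMc, hMt, hNc, hNt, Zg_pow, Zg_pow, Zg_pow, pow_add]
  have hb : ((-1 : ℂ) ^ b) * (-1) ^ b = 1 := by rw [← mul_pow]; simp
  fin_cases p <;> fin_cases q <;> fin_cases x <;> fin_cases y <;> simp <;>
    grind

lemma semiconjBy_CNOTg_ZX {n : ℕ} {c t : Fin n} (h : c ≠ t)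
    {M N : Fin n → Matrix (Fin 2) (Fin 2) ℂ} (hoff : ∀ m, m ≠ c → m ≠ t → M m = N m)
    (a b : ℕ) (hMc : M c = Zg ^ a * Xg) (hMt : M t = Zg ^ b)
    (hNc : N c = Zg ^ (b + a) * Xg) (hNt : N t = Zg ^ b * Xg) :
    SemiconjBy (CNOTg c t) (tens M) (tens N) := by
  refine semiconjBy_CNOTg h hoff fun p q x y => ?_
  rw [hMc, hMt, hNc, hNt, Zg_pow, Zg_pow, Zg_pow, pow_add]
  have hb : ((-1 : ℂ) ^ b) * (-1) ^ b = 1 := by rw [← mul_pow]; simp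
  fin_cases p <;> fin_cases q <;> fin_cases x <;> fin_cases y <;> simp [Xg] <;>
    grind

lemma semiconjBy_CI_Z (i j k a : ℕ) :
    SemiconjBy CI (tens ![Zg ^ i, Zg ^ j, Zg ^ k, Zg ^ a, 1, 1, 1])
      (tens ![Zg ^ i, Zg ^ j, Zg ^ k, Zg ^ (i + (j + (k + a))), 1, 1, 1]) := by
  refine SemiconjBy.mul_left (SemiconjBy.mul_left
    (y := tens ![Zg ^ i, Zg ^ j, Zg ^ k, Zg ^ (j + (k + a)), 1, 1, 1])
    (semiconjBy_CNOTg_Z (by decide) ?_ _ i rfl rfl rfl rfl)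
    (semiconjBy_CNOTg_Z (by decide) ?_ _ j rfl rfl rfl rfl))
    (y := tens ![Zg ^ i, Zg ^ j, Zg ^ k, Zg ^ (k + a), 1, 1, 1])
    (semiconjBy_CNOTg_Z (by decide) ?_ _ k rfl rfl rfl rfl) <;>
  · intro m
    fin_cases m <;> simp

lemma semiconjBy_CI_ZX (i j k a : ℕ) :
    SemiconjBy CI (tens ![Zg ^ i, Zg ^ j, Zg ^ k, Zg ^ a * Xg, 1, 1, 1])
      (tens ![Zg ^ i * Xg, Zg ^ j * Xg, Zg ^ k * Xg,
        Zg ^ (i + (j + (k + a))) * Xg, 1, 1, 1]) := by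
  refine SemiconjBy.mul_left (SemiconjBy.mul_left
    (y := tens ![Zg ^ i, Zg ^ j * Xg, Zg ^ k * Xg, Zg ^ (j + (k + a)) * Xg, 1, 1, 1])
    (semiconjBy_CNOTg_ZX (by decide) ?_ _ i rfl rfl rfl rfl)
    (semiconjBy_CNOTg_ZX (by decide) ?_ _ j rfl rfl rfl rfl))
    (y := tens ![Zg ^ i, Zg ^ j, Zg ^ k * Xg, Zg ^ (k + a) * Xg, 1, 1, 1])
    (semiconjBy_CNOTg_ZX (by decide) ?_ _ k rfl rfl rfl rfl) <;>
  · intro m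
    fin_cases m <;> simp

lemma commute_CII (A B C : Matrix (Fin 2) (Fin 2) ℂ) :
    Commute CII (tens ![A, B, C, 1, 1, 1, 1]) := by
  refine Commute.mul_left (Commute.mul_left ?_ ?_) ?_ <;>
  exact semiconjBy_CNOTg_Z (by decide) (fun _ _ _ => rfl) 0 0 rfl rfl rfl rfl

lemma Hg_mul_conjTranspose : Hg * Hgᴴ = 1 := by
  have h : ((Real.sqrt 2 : ℝ) : ℂ)⁻¹ * ((Real.sqrt 2 : ℝ) : ℂ)⁻¹ = 1 / 2 := by
    rw [← mul_inv, ← Complex.ofReal_mul, Real.mul_self_sqrt (by norm_num)]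
    simp
  ext p q
  fin_cases p <;> fin_cases q <;> simp [Hg, Matrix.mul_apply] <;> linear_combination 2 * h

lemma semiconjBy_Hg_Zg : SemiconjBy Hg Zg Xg := by
  ext p q
  fin_cases p <;> fin_cases q <;> simp [Hg, Zg, Xg, Matrix.mul_apply]

lemma Zg_mul_conjTranspose : Zg * Zgᴴ = 1 := by
  ext p q
  fin_cases p <;> fin_cases q <;> simp [Zg, Matrix.mul_apply]

lemma semiconjBy_tens_center {U D E : Matrix (Fin 2) (Fin 2) ℂ} (h : SemiconjBy U D E)
    (A B C : Matrix (Fin 2) (Fin 2) ℂ) :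
    SemiconjBy (tens ![1, 1, 1, U, 1, 1, 1]) (tens ![A, B, C, D, 1, 1, 1])
      (tens ![A, B, C, E, 1, 1, 1]) := by
  refine semiconjBy_tens fun m => ?_
  fin_cases m
  all_goals first | exact h | exact SemiconjBy.one_left _

lemma tens_center_mem_unitaryGroup {U : Matrix (Fin 2) (Fin 2) ℂ} (h : U * Uᴴ = 1) :
    tens ![1, 1, 1, U, 1, 1, 1] ∈ unitaryGroup (Fin 7 → Fin 2) ℂ := by
  refine tens_mem_unitaryGroup fun m => ?_
  fin_cases m <;> simp [h]

lemma W1y_mem_unitaryGroup : W1y ∈ unitaryGroup (Fin 7 → Fin 2) ℂ := by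
  have hI : CI ∈ unitaryGroup (Fin 7 → Fin 2) ℂ :=
    mul_mem (mul_mem (CNOTg_mem_unitaryGroup (by decide)) (CNOTg_mem_unitaryGroup (by decide)))
      (CNOTg_mem_unitaryGroup (by decide))
  have hII : CII ∈ unitaryGroup (Fin 7 → Fin 2) ℂ :=
    mul_mem (mul_mem (CNOTg_mem_unitaryGroup (by decide)) (CNOTg_mem_unitaryGroup (by decide)))
      (CNOTg_mem_unitaryGroup (by decide))
  have hH := tens_center_mem_unitaryGroup Hg_mul_conjTranspose
  have hZ := tens_center_mem_unitaryGroup Zg_mul_conjTranspose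
  exact mul_mem (mul_mem (mul_mem (mul_mem (mul_mem (mul_mem hI hH) hZ) hI) hII) hH) hI

lemma semiconjBy_W1y {i j k : ℕ} (hodd : Odd (i + j + k)) :
    SemiconjBy W1y (tens ![Zg ^ i, Zg ^ j, Zg ^ k, Zg, 1, 1, 1])
      (tens ![Zg ^ i * Xg, Zg ^ j * Xg, Zg ^ k * Xg, Zg * Xg, 1, 1, 1]) := by
  have h₁ := semiconjBy_CI_Z i j k 1
  rw [Zg_pow_of_even (a := i + (j + (k + 1))) (by simpa [add_assoc] using hodd.add_one),
    pow_one] at h₁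
  have h₂ := semiconjBy_CI_Z i j k 0
  have h₃ := semiconjBy_CI_ZX i j k 0
  rw [Zg_pow_of_odd (a := i + (j + (k + 0))) (by simpa [add_assoc] using hodd), pow_zero] at h₂ h₃
  rw [one_mul] at h₃
  exact (((((h₃.mul_left (semiconjBy_tens_center semiconjBy_Hg_Zg _ _ _)).mul_left
    (semiconjBy_tens_center (Commute.refl Zg) _ _ _)).mul_left h₂).mul_left
    (commute_CII _ _ _)).mul_left
    (semiconjBy_tens_center (SemiconjBy.one_right Hg) _ _ _)).mul_left h₁

lemma Zg_pow_mul_Xg (i : Fin 2) : Zg ^ (i : ℕ) * Xg = Complex.I ^ (i : ℕ) • Pg i := by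
  fin_cases i <;> simp [Pg, Zg, Xg, Yg]

theorem stmt3 (i j k : Fin 2) (hodd : Odd ((i : ℕ) + (j : ℕ) + (k : ℕ))) :
    Complex.I ^ ((i : ℕ) + (j : ℕ) + (k : ℕ) + 1) •
      (W1y * tens ![Zg ^ (i : ℕ), Zg ^ (j : ℕ), Zg ^ (k : ℕ), Zg, 1, 1, 1] * W1yᴴ) =
    tens ![Pg i, Pg j, Pg k, Yg, 1, 1, 1] := by
  have hW := mem_unitaryGroup_iff.1 W1y_mem_unitaryGroup
  rw [star_eq_conjTranspose] at hW
  rw [(semiconjBy_W1y hodd).eq, Matrix.mul_assoc, hW, Matrix.mul_one]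
  have hZX : Zg * Xg = Complex.I • Yg := by simpa [Pg] using Zg_pow_mul_Xg 1
  have hvec : ![Zg ^ (i : ℕ) * Xg, Zg ^ (j : ℕ) * Xg, Zg ^ (k : ℕ) * Xg, Zg * Xg, 1, 1, 1] =
      fun m => (![Complex.I ^ (i : ℕ), Complex.I ^ (j : ℕ), Complex.I ^ (k : ℕ), Complex.I,
        1, 1, 1] : Fin 7 → ℂ) m • ![Pg i, Pg j, Pg k, Yg, 1, 1, 1] m := by
    funext m
    fin_cases m <;> simp [Zg_pow_mul_Xg, hZX]
  have hprod : ∏ m, (![Complex.I ^ (i : ℕ), Complex.I ^ (j : ℕ), Complex.I ^ (k : ℕ), Complex.I,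
      1, 1, 1] : Fin 7 → ℂ) m = Complex.I ^ ((i : ℕ) + (j : ℕ) + (k : ℕ) + 1) := by
    simp [Fin.prod_univ_succ, pow_add, mul_assoc]
  rw [hvec, tens_smul, hprod, smul_smul, ← mul_pow, Complex.I_mul_I, hodd.add_one.neg_one_pow,
    one_smul]
end
end
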